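/- Assume ‖·‖ is an admissible norm on ℝ³, let f : M → ℝ³ be an immersed surface with Birkhoff normal field η, and let G : ℝ³ → ℝ³ be a surjective isometry of the normed space (‖G(x) − G(y)‖ = ‖x − y‖ for all x, y). Then, up to sign, the Minkowski normal curvature of M at each point is invariant under G: |k_{M,p}(X)| = |k_{G(M),G(p)}(dG(X))| for every p ∈ M and nonzero X ∈ T_pM. In particular, the Minkowski Gaussian curvature is invariant: K_{G(M)}(G(p)) = K_M(p) for every p ∈ M. -/

import Mathlib

/-!
Differential geometry of immersed surfaces in three-dimensional normed
(Minkowski) spaces, following Balestro–Martini–Teixeira.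

`E3 = ℝ³` carries its standard Euclidean inner product and, in addition, a
norm `N` which is strictly convex and smooth.  Surfaces are given in a local
parametrization `f : P2 → E3` (an immersion on an open set `U`), endowed with
a Birkhoff normal field `η`.
-/

noncomputable section

open scoped InnerProductSpace

abbrev E3 := EuclideanSpace ℝ (Fin 3)
abbrev P2 := EuclideanSpace ℝ (Fin 2)

/-- A smooth, strictly convex norm on `ℝ³` (a Minkowski norm). -/
structure MinkowskiNorm3 where
  N : E3 → ℝ
  nonneg : ∀ x, 0 ≤ N x
  eq_zero_iff : ∀ x, N x = 0 ↔ x = 0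
  smul_eq : ∀ (c : ℝ) (x : E3), N (c • x) = |c| * N x
  triangle : ∀ x y, N (x + y) ≤ N x + N y
  strict_triangle : ∀ x y : E3, LinearIndependent ℝ ![x, y] → N (x + y) < N x + N y
  smooth : ContDiffOn ℝ (⊤ : ℕ∞) N {x : E3 | x ≠ 0}

namespace MinkowskiNorm3

/-- Birkhoff orthogonality of a vector `v` to a set (e.g. a plane) `H`:
`‖v + w‖ ≥ ‖v‖` for all `w ∈ H`. -/
def BirkhoffOrth (m : MinkowskiNorm3) (v : E3) (H : Set E3) : Prop :=
  ∀ w ∈ H, m.N v ≤ m.N (v + w)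

/-- The (outward) Euclidean Gauss map of the unit sphere `∂B` of the norm,
expressed on ambient space as the normalized gradient of `N`.  Restricted to
`∂B` it is the map `u⁻¹ : ∂B → ∂B_e`, whose inverse is `u : ∂B_e → ∂B`. -/
def sphereGauss (m : MinkowskiNorm3) (v : E3) : E3 :=
  ‖gradient m.N v‖⁻¹ • gradient m.N v

/-- The differential `du⁻¹` at a point `v ∈ ∂B`, applied to a vector `w`
(its restriction to the tangent plane of `∂B` at `v` is the inverse of
`du_{u⁻¹(v)}`). -/
def duInv (m : MinkowskiNorm3) (v w : E3) : E3 :=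
  fderiv ℝ m.sphereGauss v w

/-- Admissibility of the norm: the unit sphere `∂B` has positive Euclidean
Gaussian curvature at every point; equivalently, the second fundamental form
of `∂B` with respect to the outward normal is positive definite, i.e.
`⟪du⁻¹ w, w⟫ > 0` for every nonzero vector `w` tangent to `∂B`. -/
def Admissible (m : MinkowskiNorm3) : Prop :=
  ∀ v : E3, m.N v = 1 → ∀ w : E3, w ≠ 0 → fderiv ℝ m.N v w = 0 →
    0 < ⟪m.duInv v w, w⟫_ℝ

end MinkowskiNorm3

/-- An immersed surface (in a local parametrization on an open set `U ⊆ ℝ²`)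
in the Minkowski space `(ℝ³, m)`, endowed with a Birkhoff normal vector
field `η`: a smooth unit field with `η(p) ⊣_B T_pM` for all `p`. -/
structure BSurface (m : MinkowskiNorm3) where
  U : Set P2
  isOpen : IsOpen U
  f : P2 → E3
  smooth_f : ContDiffOn ℝ (⊤ : ℕ∞) f U
  immersion : ∀ p ∈ U, Function.Injective (fderiv ℝ f p)
  η : P2 → E3
  smooth_η : ContDiffOn ℝ (⊤ : ℕ∞) η U
  unit_η : ∀ p ∈ U, m.N (η p) = 1
  birkhoff : ∀ p ∈ U, m.BirkhoffOrth (η p) (Set.range (fderiv ℝ f p))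

namespace BSurface

variable {m : MinkowskiNorm3}

/-- The tangent plane `T_pM`, identified (via the push-forward `df_p`) with a
linear plane in ambient `ℝ³`. -/
def tangent (S : BSurface m) (p : P2) : Set E3 := Set.range (fderiv ℝ S.f p)

/-- `h : P2 → P2 → ℝ` (in the parameter coordinates, i.e. `h v w` stands for
`h(df_p v, df_p w)`) is the affine fundamental form of the immersion at `p`,
determined by the Gauss formula `D_X Y = ∇_X Y + h(X,Y) η`: for coordinate
directions `v, w`, the second derivative `D_v D_w f` minus `h v w • η p` is
tangential. -/
def IsAffineFundForm (S : BSurface m) (p : P2) (h : P2 → P2 → ℝ) : Prop :=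
  ∀ v w : P2,
    fderiv ℝ (fun q => fderiv ℝ S.f q w) p v - h v w • S.η p ∈ S.tangent p

end BSurface

/-- The Minkowski normal curvature of the surface parametrized by `f` with
Birkhoff normal field `η`, at `p`, in the tangent direction `X = df_p v`:
`k_{M,p}(X) = ⟪du⁻¹_{η(p)} X, dη_p X⟫ / ⟪du⁻¹_{η(p)} X, X⟫`, using the natural
identification of the parallel planes `T_pM ≅ T_{η(p)}∂B ≅ T_{ξ(p)}∂B_e`. -/
def normalCurv (m : MinkowskiNorm3) (f η : P2 → E3) (p v : P2) : ℝ :=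
  ⟪m.duInv (η p) (fderiv ℝ f p v), fderiv ℝ η p v⟫_ℝ /
    ⟪m.duInv (η p) (fderiv ℝ f p v), fderiv ℝ f p v⟫_ℝ

/-- **Mazur–Ulam** for a norm given as a function on a bare real vector space. -/
theorem exists_linearMap_of_surjective_of_norm_sub_eq {V : Type*} [AddCommGroup V] [Module ℝ V]
    (N : V → ℝ) (eq_zero_iff : ∀ x, N x = 0 ↔ x = 0)
    (smul_eq : ∀ (c : ℝ) (x : V), N (c • x) = |c| * N x)
    (triangle : ∀ x y, N (x + y) ≤ N x + N y)
    (G : V → V) (hG : Function.Surjective G) (hiso : ∀ x y, N (G x - G y) = N (x - y)) :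
    ∃ L : V →ₗ[ℝ] V, ∀ x, G x = L x + G 0 := by
  let A : AddGroupNorm V :=
    { toFun := N
      map_zero' := (eq_zero_iff 0).2 rfl
      add_le' := triangle
      neg' := fun x => by simpa using smul_eq (-1) x
      eq_zero_of_map_eq_zero' := fun x => (eq_zero_iff x).1 }
  let _ : NormedAddCommGroup V := A.toNormedAddCommGroup
  let _ : NormedSpace ℝ V := { norm_smul_le := fun c x => (smul_eq c x).le }
  have hG' : Isometry G := Isometry.of_dist_eq fun x y => by
    rw [dist_eq_norm, dist_eq_norm]
    exact hiso x y
  let e : V ≃ᵢ V := ⟨Equiv.ofBijective G ⟨hG'.injective, hG⟩, hG'⟩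
  refine ⟨e.toRealLinearIsometryEquiv.toLinearEquiv.toLinearMap, fun x => ?_⟩
  have h : e.toRealLinearIsometryEquiv x = G x - G 0 := e.toRealLinearIsometryEquiv_apply x
  exact (sub_eq_iff_eq_add.1 h.symm)

/-- If `B = A ∘ T` with `A` injective and `T` diagonalizable, the eigenvalues of `T` in any two
eigenbases have the same product. -/
theorem eigenvalue_mul_eq_of_injective {W : Type*} [AddCommGroup W] [Module ℝ W]
    (A B : P2 →ₗ[ℝ] W) (hA : Function.Injective A) {a₁ a₂ b₁ b₂ : ℝ} {v₁ v₂ w₁ w₂ : P2}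
    (hv : LinearIndependent ℝ ![v₁, v₂]) (hw : LinearIndependent ℝ ![w₁, w₂])
    (hv₁ : B v₁ = a₁ • A v₁) (hv₂ : B v₂ = a₂ • A v₂)
    (hw₁ : B w₁ = b₁ • A w₁) (hw₂ : B w₂ = b₂ • A w₂) :
    a₁ * a₂ = b₁ * b₂ := by
  have key : ∀ {a₁ a₂ : ℝ} {v₁ v₂ : P2}, LinearIndependent ℝ ![v₁, v₂] →
      B v₁ = a₁ • A v₁ → B v₂ = a₂ • A v₂ →
      ∃ T : P2 →ₗ[ℝ] P2, A ∘ₗ T = B ∧ LinearMap.det T = a₁ * a₂ := by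
    intro a₁ a₂ v₁ v₂ h h₁ h₂
    let b := basisOfLinearIndependentOfCardEqFinrank h (by simp)
    have hb : ⇑b = ![v₁, v₂] := coe_basisOfLinearIndependentOfCardEqFinrank _ _
    refine ⟨Matrix.toLin b b (Matrix.diagonal ![a₁, a₂]), b.ext fun i => ?_, ?_⟩
    · rw [LinearMap.comp_apply, Matrix.toLin_self]
      fin_cases i <;> simp [hb, h₁, h₂]
    · rw [LinearMap.det_toLin]
      simp
  obtain ⟨T, hT, hTd⟩ := key hv hv₁ hv₂
  obtain ⟨T', hT', hTd'⟩ := key hw hw₁ hw₂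
  have : T = T' := LinearMap.ext fun x => hA <|
    LinearMap.congr_fun (hT.trans hT'.symm) x
  rw [← hTd, ← hTd', this]

namespace MinkowskiNorm3

variable (m : MinkowskiNorm3)

theorem contDiffAt {v : E3} (hv : v ≠ 0) : ContDiffAt ℝ (⊤ : ℕ∞) m.N v :=
  m.smooth.contDiffAt (isOpen_ne.mem_nhds hv)

theorem differentiableAt {v : E3} (hv : v ≠ 0) : DifferentiableAt ℝ m.N v :=
  (m.contDiffAt hv).differentiableAt (by simp)

theorem differentiableAt_gradient {v : E3} (hv : v ≠ 0) :
    DifferentiableAt ℝ (gradient m.N) v := by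
  have h : DifferentiableAt ℝ (fderiv ℝ m.N) v :=
    ((m.contDiffAt hv).fderiv_right (m := 1) (WithTop.coe_le_coe.2 le_top)).differentiableAt (by simp)
  exact (InnerProductSpace.toDual ℝ E3).symm.differentiableAt.comp v h

theorem inner_gradient (v w : E3) : ⟪gradient m.N v, w⟫_ℝ = fderiv ℝ m.N v w := by
  simp [gradient]

/-- Euler's identity for the norm. -/
theorem fderiv_self {v : E3} (hv : v ≠ 0) : fderiv ℝ m.N v v = m.N v := by
  have hs : HasDerivAt (fun t : ℝ => t • v) v 1 := by
    simpa using (hasDerivAt_id (1 : ℝ)).smul_const v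
  have hN : HasFDerivAt m.N (fderiv ℝ m.N v) ((1 : ℝ) • v) := by
    simpa using (m.differentiableAt hv).hasFDerivAt
  have h₁ := hN.comp_hasDerivAt (1 : ℝ) hs
  have h₂ : HasDerivAt (fun t : ℝ => t * m.N v) (m.N v) 1 := by
    simpa using (hasDerivAt_id (1 : ℝ)).mul_const (m.N v)
  refine h₁.unique (h₂.congr_of_eventuallyEq ?_)
  filter_upwards [lt_mem_nhds (zero_lt_one (α := ℝ))] with t ht
  simp [m.smul_eq, abs_of_pos ht]

theorem gradient_ne_zero {v : E3} (hv : v ≠ 0) : gradient m.N v ≠ 0 := by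
  intro h
  have := m.fderiv_self hv
  rw [← inner_gradient, h, inner_zero_left] at this
  exact hv ((m.eq_zero_iff v).1 this.symm)

/-- A vector Birkhoff orthogonal to a line has gradient vanishing on this line. -/
theorem fderiv_eq_zero_of_forall_le {v w : E3} (hv : v ≠ 0)
    (h : ∀ t : ℝ, m.N v ≤ m.N (v + t • w)) : fderiv ℝ m.N v w = 0 := by
  have hs : HasDerivAt (fun t : ℝ => v + t • w) w 0 := by
    simpa using ((hasDerivAt_id (0 : ℝ)).smul_const w).const_add v
  have hN : HasFDerivAt m.N (fderiv ℝ m.N v) (v + (0 : ℝ) • w) := by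
    simpa using (m.differentiableAt hv).hasFDerivAt
  refine IsLocalMin.hasDerivAt_eq_zero (f := fun t : ℝ => m.N (v + t • w)) (a := 0) ?_
    (hN.comp_hasDerivAt (0 : ℝ) hs)
  exact Filter.Eventually.of_forall fun t => by simpa using h t

/-- On tangent vectors, `du⁻¹` is a multiple of the Hessian of the norm. -/
theorem inner_duInv {v z : E3} (hv : v ≠ 0) (hz : fderiv ℝ m.N v z = 0) (w : E3) :
    ⟪m.duInv v w, z⟫_ℝ =
      ‖gradient m.N v‖⁻¹ * ⟪fderiv ℝ (gradient m.N) v w, z⟫_ℝ := by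
  have hg := m.differentiableAt_gradient hv
  have hn : DifferentiableAt ℝ (fun x => ‖gradient m.N x‖⁻¹) v :=
    (hg.norm ℝ (m.gradient_ne_zero hv)).inv (norm_ne_zero_iff.2 (m.gradient_ne_zero hv))
  have h : fderiv ℝ m.sphereGauss v = _ := fderiv_fun_smul hn hg
  rw [duInv, h]
  simp [inner_add_left, inner_smul_left, hz]

/-- A linear isometry of the norm preserves tangency to the spheres of the norm. -/
theorem fderiv_map (L : E3 →L[ℝ] E3) (hL : ∀ x, m.N (L x) = m.N x) {v : E3} (hv : L v ≠ 0)
    (z : E3) : fderiv ℝ m.N (L v) (L z) = fderiv ℝ m.N v z := by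
  have h := ((m.differentiableAt hv).hasFDerivAt.comp v L.hasFDerivAt).fderiv
  rw [show m.N ∘ L = m.N from funext hL] at h
  rw [h]
  rfl

/-- A linear isometry of the norm preserves its Hessian. -/
theorem inner_fderiv_gradient_map (L : E3 →L[ℝ] E3) (hL : ∀ x, m.N (L x) = m.N x)
    {v : E3} (hv : v ≠ 0) (w z : E3) :
    ⟪fderiv ℝ (gradient m.N) (L v) (L w), L z⟫_ℝ = ⟪fderiv ℝ (gradient m.N) v w, z⟫_ℝ := by
  have hL0 : ∀ {x : E3}, x ≠ 0 → L x ≠ 0 := fun {x} hx h =>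
    hx ((m.eq_zero_iff x).1 ((hL x).symm.trans ((m.eq_zero_iff _).2 h)))
  have hgrad : (fun x => ⟪gradient m.N (L x), L z⟫_ℝ) =ᶠ[nhds v]
      fun x => ⟪gradient m.N x, z⟫_ℝ := by
    filter_upwards [isOpen_ne.mem_nhds hv] with x hx
    rw [inner_gradient, inner_gradient, m.fderiv_map L hL (hL0 hx)]
  have h₁ := ((m.differentiableAt_gradient (hL0 hv)).hasFDerivAt.comp v L.hasFDerivAt).inner ℝ
    (hasFDerivAt_const (L z) v)
  have h₂ := (m.differentiableAt_gradient hv).hasFDerivAt.inner ℝ (hasFDerivAt_const z v)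
  have h := congrArg (fun T => T w) ((h₂.congr_of_eventuallyEq hgrad).unique h₁)
  simpa using h.symm

end MinkowskiNorm3

namespace BSurface

variable {m : MinkowskiNorm3} (S : BSurface m) {p : P2}

theorem differentiableAt_f (hp : p ∈ S.U) : DifferentiableAt ℝ S.f p :=
  (S.smooth_f.contDiffAt (S.isOpen.mem_nhds hp)).differentiableAt (by simp)

theorem differentiableAt_η (hp : p ∈ S.U) : DifferentiableAt ℝ S.η p :=
  (S.smooth_η.contDiffAt (S.isOpen.mem_nhds hp)).differentiableAt (by simp)

theorem η_ne_zero (hp : p ∈ S.U) : S.η p ≠ 0 := fun h => by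
  have := S.unit_η p hp
  rw [(m.eq_zero_iff _).2 h] at this
  exact zero_ne_one this

theorem fderiv_norm_fderiv_f (hp : p ∈ S.U) (v : P2) :
    fderiv ℝ m.N (S.η p) (fderiv ℝ S.f p v) = 0 :=
  m.fderiv_eq_zero_of_forall_le (S.η_ne_zero hp) fun t =>
    S.birkhoff p hp _ ⟨t • v, map_smul _ _ _⟩

theorem fderiv_norm_fderiv_η (hp : p ∈ S.U) (v : P2) :
    fderiv ℝ m.N (S.η p) (fderiv ℝ S.η p v) = 0 := by
  have h := (m.differentiableAt (S.η_ne_zero hp)).hasFDerivAt.comp p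
    (S.differentiableAt_η hp).hasFDerivAt
  have hc : m.N ∘ S.η =ᶠ[nhds p] fun _ => 1 := by
    filter_upwards [S.isOpen.mem_nhds hp] with q hq using S.unit_η q hq
  exact congrArg (fun T => T v) (h.unique ((hasFDerivAt_const (1 : ℝ) p).congr_of_eventuallyEq hc))

end BSurface

/-- If `G` is a surjective isometry of the normed space
`(ℝ³, ‖·‖)`, then, up to sign, the Minkowski normal curvature of `M` is
invariant under `G` (the image surface `G(M)` being parametrized by `G ∘ f`
and endowed with the Birkhoff normal field obtained from `η` via the linear
part `x ↦ G(x) - G(0)` of `G`); in particular, the Minkowski Gaussian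
curvature is invariant under `G`. -/
theorem normal_curvature_isometry_invariant (m : MinkowskiNorm3)
    (hadm : m.Admissible) (S : BSurface m)
    (G : E3 → E3) (hGsurj : Function.Surjective G)
    (hGiso : ∀ x y : E3, m.N (G x - G y) = m.N (x - y))
    (p : P2) (hp : p ∈ S.U) (v : P2) (hv : v ≠ 0) :
    |normalCurv m (fun q => G (S.f q)) (fun q => G (S.η q) - G 0) p v| =
      |normalCurv m S.f S.η p v| ∧
    (∀ lam₁ lam₂ mu₁ mu₂ : ℝ,
      (∃ v₁ v₂ : P2, LinearIndependent ℝ ![v₁, v₂] ∧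
        fderiv ℝ S.η p v₁ = lam₁ • fderiv ℝ S.f p v₁ ∧
        fderiv ℝ S.η p v₂ = lam₂ • fderiv ℝ S.f p v₂) →
      (∃ w₁ w₂ : P2, LinearIndependent ℝ ![w₁, w₂] ∧
        fderiv ℝ (fun q => G (S.η q) - G 0) p w₁ =
          mu₁ • fderiv ℝ (fun q => G (S.f q)) p w₁ ∧
        fderiv ℝ (fun q => G (S.η q) - G 0) p w₂ =
          mu₂ • fderiv ℝ (fun q => G (S.f q)) p w₂) →
      lam₁ * lam₂ = mu₁ * mu₂) := by
  obtain ⟨L₀, hL₀⟩ := exists_linearMap_of_surjective_of_norm_sub_eq m.N m.eq_zero_iff m.smul_eq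
    m.triangle G hGsurj hGiso
  let L : E3 →L[ℝ] E3 := LinearMap.toContinuousLinearMap L₀
  have hGL : ∀ x, G x = L x + G 0 := hL₀
  have hLN : ∀ x, m.N (L x) = m.N x := fun x => by
    simpa [hGL x] using hGiso x 0
  have hL0 : ∀ x, L x = 0 → x = 0 := fun x hx => by
    rw [← m.eq_zero_iff, ← hLN, hx, m.eq_zero_iff]
  have hLinj : Function.Injective L := (injective_iff_map_eq_zero L).2 hL0
  have hf : fderiv ℝ (fun q => G (S.f q)) p = L ∘L fderiv ℝ S.f p := by
    simp_rw [hGL (S.f _)]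
    exact ((L.hasFDerivAt.comp p (S.differentiableAt_f hp).hasFDerivAt).add_const (G 0)).fderiv
  have hηL : (fun q => G (S.η q) - G 0) = fun q => L (S.η q) := by
    funext q
    rw [hGL (S.η q), add_sub_cancel_right]
  have hη : fderiv ℝ (fun q => L (S.η q)) p = L ∘L fderiv ℝ S.η p :=
    (L.hasFDerivAt.comp p (S.differentiableAt_η hp).hasFDerivAt).fderiv
  have hη0 := S.η_ne_zero hp
  have hLη0 : L (S.η p) ≠ 0 := fun h => hη0 (hL0 _ h)
  rw [hηL, hf, hη]
  refine ⟨congrArg _ ?_, ?_⟩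
  · have hquot : ∀ a b x y : ℝ, a ≠ 0 → b ≠ 0 → a * x / (a * y) = b * x / (b * y) :=
      fun a b x y ha hb => by rw [mul_div_mul_left _ _ ha, mul_div_mul_left _ _ hb]
    have hX := S.fderiv_norm_fderiv_f hp v
    have hY := S.fderiv_norm_fderiv_η hp v
    simp only [normalCurv, hf, hη, ContinuousLinearMap.comp_apply]
    rw [m.inner_duInv hη0 hX, m.inner_duInv hη0 hY,
      m.inner_duInv hLη0 ((m.fderiv_map L hLN hLη0 _).trans hX),
      m.inner_duInv hLη0 ((m.fderiv_map L hLN hLη0 _).trans hY),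
      m.inner_fderiv_gradient_map L hLN hη0, m.inner_fderiv_gradient_map L hLN hη0]
    exact hquot _ _ _ _ (inv_ne_zero (norm_ne_zero_iff.2 (m.gradient_ne_zero hLη0)))
      (inv_ne_zero (norm_ne_zero_iff.2 (m.gradient_ne_zero hη0)))
  · rintro lam₁ lam₂ mu₁ mu₂ ⟨v₁, v₂, hv₁₂, hv₁, hv₂⟩ ⟨w₁, w₂, hw₁₂, hw₁, hw₂⟩
    simp only [ContinuousLinearMap.comp_apply, ← map_smul] at hw₁ hw₂
    exact eigenvalue_mul_eq_of_injective (fderiv ℝ S.f p).toLinearMap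
      (fderiv ℝ S.η p).toLinearMap (S.immersion p hp) hv₁₂ hw₁₂ hv₁ hv₂
      ((hLinj hw₁).trans (map_smul _ _ _)) ((hLinj hw₂).trans (map_smul _ _ _))
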